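/- (Remark 2, tighter bound.) Let x^R be an optimal solution of SYS-LP such that for every tier t there is at most one user i with 0 < x^R_{i,t} < J_i. Define ŷ_{i,t} := 1 if Σ_{s=1}^t x^R_{i,s} ≥ J_i and 0 otherwise, and V̂ := Σ_{t=1}^T Σ_{i=1}^N u_{i,t} ŷ_{i,t}. Then V̂ ≥ (1 − (max_i J_i)/(min_t M_t)) · V^R, where V^R is the optimal value of SYS-LP. -/

import Mathlib

open Finset

/-- Feasibility for SYS-LP. -/
def LPFeasible (N T : ℕ) (J M : ℕ → ℝ) (x : ℕ → ℕ → ℝ) : Prop :=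
  (∀ i t, 0 ≤ x i t) ∧
  (∀ i ∈ Finset.Icc 1 N, (∑ t ∈ Finset.Icc 1 T, x i t) ≤ J i) ∧
  (∀ t ∈ Finset.Icc 1 T, (∑ i ∈ Finset.Icc 1 N, x i t) ≤ M t)

/-- The SYS-LP objective `Σ_i Σ_t x_{i,t} F_{i,t}` with `F_{i,t} = U_{i,t}/J_i`. -/
noncomputable def LPObj (N T : ℕ) (J : ℕ → ℝ) (U : ℕ → ℕ → ℝ) (x : ℕ → ℕ → ℝ) : ℝ :=
  ∑ i ∈ Finset.Icc 1 N, ∑ t ∈ Finset.Icc 1 T, x i t * (U i t / J i)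

/-- The rounded value `V̂ = Σ_t Σ_i u_{i,t} ŷ_{i,t}` where `ŷ_{i,t}` indicates whether
user `i`'s job is completed by tier `t` under `x`, and `u_{i,t} = U_{i,t} − U_{i,t+1}`. -/
noncomputable def roundedValue (N T : ℕ) (J : ℕ → ℝ) (U : ℕ → ℕ → ℝ)
    (x : ℕ → ℕ → ℝ) : ℝ :=
  ∑ t ∈ Finset.Icc 1 T, ∑ i ∈ Finset.Icc 1 N,
    (U i t - U i (t + 1)) *
      (if J i ≤ ∑ s ∈ Finset.Icc 1 t, x i s then (1 : ℝ) else 0)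

theorem indicator_sub_cases {p q i : ℕ} {c a : ℝ} (h0 : 0 ≤ c) (h1 : c ≤ 1)
    (ha : a = (if i = p then 1 else 0) - c * (if i = q then 1 else 0)) :
    (i = p ∧ 0 ≤ a ∧ a ≤ 1) ∨ (i = q ∧ a = -c) ∨ a = 0 := by
  rw [ha]
  by_cases hp : i = p
  · refine Or.inl ⟨hp, ?_⟩
    split_ifs <;> constructor <;> linarith
  · by_cases hq : i = q
    · exact Or.inr (Or.inl ⟨hq, by rw [if_neg hp, if_pos hq]; ring⟩)
    · exact Or.inr (Or.inr (by rw [if_neg hp, if_neg hq]; ring))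

/-- Perturbing a solution of SYS-LP by a rank-one exchange: user `p` gains in tier `t`, at the
expense of a share `lam` from user `q`, and gives back a share `kap` in tier `l`. -/
theorem exchange_le {N T : ℕ} {J M : ℕ → ℝ} {U x : ℕ → ℕ → ℝ}
    (hfeas : LPFeasible N T J M x)
    (hopt : ∀ y, LPFeasible N T J M y → LPObj N T J U y ≤ LPObj N T J U x)
    {p q t l : ℕ} (hp : p ∈ Icc 1 N) (hq : q ∈ Icc 1 N) (ht : t ∈ Icc 1 T) (hl : l ∈ Icc 1 T)
    {lam kap A B : ℝ} (hlam : 0 ≤ lam) (hlam1 : lam ≤ 1) (hkap : 0 ≤ kap) (hkap1 : kap ≤ 1)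
    (hA : 0 < A) (hB : 0 < B) (hAl : kap * A ≤ x p l)
    (hAJ : (1 - kap) * A ≤ J p - ∑ s ∈ Icc 1 T, x p s)
    (hBq : lam * B ≤ x q t) (hBM : (1 - lam) * B ≤ M t - ∑ i ∈ Icc 1 N, x i t) :
    U p t / J p - kap * (U p l / J p) ≤ lam * (U q t / J q - kap * (U q l / J q)) := by
  obtain ⟨e, he, heA, heB⟩ : ∃ e : ℝ, 0 < e ∧ e ≤ A ∧ e ≤ B :=
    ⟨min A B, lt_min hA hB, min_le_left _ _, min_le_right _ _⟩
  obtain ⟨hx, hxJ, hxM⟩ := hfeas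
  set a : ℕ → ℝ := fun i => (if i = p then 1 else 0) - lam * (if i = q then 1 else 0) with ha
  set b : ℕ → ℝ := fun s => (if s = t then 1 else 0) - kap * (if s = l then 1 else 0) with hb
  have suma (f : ℕ → ℝ) : ∑ i ∈ Icc 1 N, a i * f i = f p - lam * f q := by
    simp only [ha, sub_mul, sum_sub_distrib, mul_assoc, ← mul_sum, ite_mul, one_mul, zero_mul,
      sum_ite_eq', hp, hq, if_true]
  have sumb (f : ℕ → ℝ) : ∑ s ∈ Icc 1 T, b s * f s = f t - kap * f l := by
    simp only [hb, sub_mul, sum_sub_distrib, mul_assoc, ← mul_sum, ite_mul, one_mul, zero_mul,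
      sum_ite_eq', ht, hl, if_true]
  have ekap : kap * e ≤ x p l := (mul_le_mul_of_nonneg_left heA hkap).trans hAl
  have elam : lam * e ≤ x q t := (mul_le_mul_of_nonneg_left heB hlam).trans hBq
  have ekap' : (1 - kap) * e ≤ J p - ∑ s ∈ Icc 1 T, x p s :=
    (mul_le_mul_of_nonneg_left heA (by linarith)).trans hAJ
  have elam' : (1 - lam) * e ≤ M t - ∑ i ∈ Icc 1 N, x i t :=
    (mul_le_mul_of_nonneg_left heB (by linarith)).trans hBM
  have hacase (i : ℕ) := indicator_sub_cases (a := a i) hlam hlam1 rfl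
  have hbcase (s : ℕ) := indicator_sub_cases (a := b s) hkap hkap1 rfl
  have hy : LPFeasible N T J M (fun i s => x i s + e * (a i * b s)) := by
    refine ⟨fun i s => ?_, fun i hi => ?_, fun s hs => ?_⟩
    · have h0 := hx i s
      change 0 ≤ x i s + e * (a i * b s)
      rcases hacase i with ⟨rfl, ha0, ha1⟩ | ⟨rfl, hai⟩ | hai
      · rcases hbcase s with ⟨-, hb0, -⟩ | ⟨rfl, hbs⟩ | hbs
        · exact add_nonneg h0 (mul_nonneg he.le (mul_nonneg ha0 hb0))
        · rw [hbs]
          linarith [mul_le_mul_of_nonneg_right ha1 (mul_nonneg hkap he.le)]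
        · simpa [hbs] using h0
      · rcases hbcase s with ⟨rfl, -, hb1⟩ | ⟨-, hbs⟩ | hbs
        · rw [hai]
          linarith [mul_le_mul_of_nonneg_right hb1 (mul_nonneg hlam he.le)]
        · rw [hai, hbs, neg_mul_neg]
          positivity
        · simpa [hbs] using h0
      · simpa [hai] using h0
    · have h0 := hxJ i hi
      have hs1 := sumb (fun _ => 1)
      simp only [mul_one] at hs1
      rw [sum_add_distrib, ← mul_sum, ← mul_sum, hs1]
      have hk1 : 0 ≤ (1 - kap) * e := mul_nonneg (by linarith) he.le
      rcases hacase i with ⟨rfl, -, h1⟩ | ⟨-, h1⟩ | h1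
      · linarith [mul_le_mul_of_nonneg_right h1 hk1]
      · rw [h1]
        linarith [mul_nonneg hlam hk1]
      · simpa [h1] using h0
    · have h0 := hxM s hs
      have hs1 := suma (fun _ => 1)
      simp only [mul_one] at hs1
      rw [sum_add_distrib, ← mul_sum, ← sum_mul, hs1]
      have hk1 : 0 ≤ (1 - lam) * e := mul_nonneg (by linarith) he.le
      rcases hbcase s with ⟨rfl, -, h1⟩ | ⟨-, h1⟩ | h1
      · linarith [mul_le_mul_of_nonneg_right h1 hk1]
      · rw [h1]
        linarith [mul_nonneg hkap hk1]
      · simpa [h1] using h0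
  have key : LPObj N T J U (fun i s => x i s + e * (a i * b s)) = LPObj N T J U x +
      e * (U p t / J p - kap * (U p l / J p) - lam * (U q t / J q - kap * (U q l / J q))) := by
    unfold LPObj
    rw [← sumb (fun s => U p s / J p), ← sumb (fun s => U q s / J q),
      ← suma (fun i => ∑ s ∈ Icc 1 T, b s * (U i s / J i))]
    simp only [mul_sum, ← sum_add_distrib]
    exact sum_congr rfl fun i _ => sum_congr rfl fun s _ => by ring
  have hle := hopt _ hy
  rw [key] at hle
  by_contra! h
  nlinarith [mul_pos he (sub_pos.mpr h)]

theorem sum_sub_succ_mul_indicator (v : ℕ → ℝ) {l : ℕ} (hl : 1 ≤ l) (n : ℕ) :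
    ∑ t ∈ Icc 1 n, (v t - v (t + 1)) * (if l ≤ t then (1 : ℝ) else 0) =
      if l ≤ n then v l - v (n + 1) else 0 := by
  induction n with
  | zero => simp; omega
  | succ n ih =>
    rw [sum_Icc_succ_top (by omega), ih]
    by_cases h1 : l ≤ n
    · simp [h1, show l ≤ n + 1 by omega]
    · by_cases h2 : l = n + 1
      · subst h2; simp
      · simp [h1, show ¬ l ≤ n + 1 by omega]

/-- The completion tier of a job of size `j` served at rates `x`; it is `T + 1` if the job is
never completed. -/
theorem exists_completion_tier {T : ℕ} {j : ℝ} (hj : 0 < j) {x v : ℕ → ℝ} (hx : ∀ t, 0 ≤ x t)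
    (hxj : ∑ t ∈ Icc 1 T, x t ≤ j) (hv : v (T + 1) = 0) :
    ∃ l, 1 ≤ l ∧ l ≤ T + 1 ∧
      ∑ t ∈ Icc 1 T, (v t - v (t + 1)) *
        (if j ≤ ∑ s ∈ Icc 1 t, x s then (1 : ℝ) else 0) = v l ∧
      (∀ t ∈ Icc 1 T, t < l → x t < j) ∧
      (l ≤ T → 0 < x l ∧ ∑ t ∈ Icc 1 T, x t = j) ∧
      (l = T + 1 → ∑ t ∈ Icc 1 T, x t < j) := by
  classical
  have hex : ∃ t, T < t ∨ j ≤ ∑ s ∈ Icc 1 t, x s := ⟨T + 1, Or.inl (by omega)⟩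
  have mono {m n : ℕ} (h : m ≤ n) : ∑ s ∈ Icc 1 m, x s ≤ ∑ s ∈ Icc 1 n, x s :=
    sum_le_sum_of_subset_of_nonneg (Icc_subset_Icc_right h) fun s _ _ => hx s
  obtain ⟨l, hspec, hmin⟩ : ∃ l, (T < l ∨ j ≤ ∑ s ∈ Icc 1 l, x s) ∧
      ∀ m < l, ¬ (T < m ∨ j ≤ ∑ s ∈ Icc 1 m, x s) :=
    ⟨Nat.find hex, Nat.find_spec hex, fun m hm => Nat.find_min hex hm⟩
  have hlT : l ≤ T + 1 := by
    by_contra! h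
    exact hmin (T + 1) h (Or.inl (by omega))
  have hl1 : 1 ≤ l := by
    by_contra! h
    obtain rfl : l = 0 := by omega
    rcases hspec with h | h
    · omega
    · simp at h; linarith
  have hiff {t : ℕ} (ht : t ∈ Icc 1 T) : j ≤ ∑ s ∈ Icc 1 t, x s ↔ l ≤ t := by
    have htT := (mem_Icc.mp ht).2
    constructor
    · intro h
      by_contra! hlt
      exact hmin t hlt (Or.inr h)
    · intro h
      exact (hspec.resolve_left (by omega)).trans (mono h)
  refine ⟨l, hl1, hlT, ?_, fun t ht htl => ?_, fun h => ⟨?_, ?_⟩, fun h => ?_⟩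
  · rw [sum_congr rfl fun t ht => by rw [if_congr (hiff ht) rfl rfl],
      sum_sub_succ_mul_indicator v hl1, hv]
    split_ifs with h
    · ring
    · rw [show l = T + 1 by omega, hv]
  · have h1 := (hiff ht).not.mpr (by omega)
    have h2 : x t ≤ ∑ s ∈ Icc 1 t, x s :=
      single_le_sum (fun s _ => hx s) (mem_Icc.mpr ⟨(mem_Icc.mp ht).1, le_rfl⟩)
    linarith
  · obtain ⟨m, rfl⟩ : ∃ m, l = m + 1 := ⟨l - 1, by omega⟩
    have h1 := hspec.resolve_left (by omega)
    rw [sum_Icc_succ_top (by omega)] at h1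
    have h2 := hmin m (by omega)
    push Not at h2
    linarith [h2.2]
  · exact le_antisymm hxj ((hspec.resolve_left (by omega)).trans (mono h))
  · have h2 := hmin T (by omega)
    push Not at h2
    exact h2.2

/-- Remark 2, tighter bound: if the optimal SYS-LP solution `x^R`
allocates partial resources to at most one user in every tier, then
`V̂ ≥ (1 − (max_i J_i)/(min_t M_t))·V^R` with `V^R = LPObj(x^R)`. -/
theorem stmt7
    (N T : ℕ) (hN : 1 ≤ N) (hT : 1 ≤ T) (J M : ℕ → ℝ) (U : ℕ → ℕ → ℝ)
    (hJ : ∀ i ∈ Finset.Icc 1 N, 0 < J i)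
    (hM : ∀ t ∈ Finset.Icc 1 T, 0 < M t)
    (hUnn : ∀ i ∈ Finset.Icc 1 N, ∀ t ∈ Finset.Icc 1 T, 0 ≤ U i t)
    (hUmono : ∀ i ∈ Finset.Icc 1 N, ∀ t ∈ Finset.Icc 1 T, ∀ t', t ≤ t' → t' ≤ T →
      U i t' ≤ U i t)
    (hU0 : ∀ i ∈ Finset.Icc 1 N, U i (T + 1) = 0)
    (xR : ℕ → ℕ → ℝ)
    (hfeas : LPFeasible N T J M xR)
    (hopt : ∀ x, LPFeasible N T J M x → LPObj N T J U x ≤ LPObj N T J U xR)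
    (honePartial : ∀ t ∈ Finset.Icc 1 T, ∀ i ∈ Finset.Icc 1 N, ∀ j ∈ Finset.Icc 1 N,
      (0 < xR i t ∧ xR i t < J i) → (0 < xR j t ∧ xR j t < J j) → i = j) :
    (1 - ((Finset.Icc 1 N).sup' (Finset.nonempty_Icc.mpr hN) J) /
        ((Finset.Icc 1 T).inf' (Finset.nonempty_Icc.mpr hT) M)) *
      LPObj N T J U xR ≤ roundedValue N T J U xR := by
  obtain ⟨hx, hxJ, hxM⟩ := id hfeas
  have hlast := fun i (hi : i ∈ Icc 1 N) =>
    exists_completion_tier (hJ i hi) (hx i) (hxJ i hi) (hU0 i hi)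
  choose! l hl1 hlT hround hpart hdone hopen using hlast
  set Jmax := (Icc 1 N).sup' (nonempty_Icc.mpr hN) J
  set Mmin := (Icc 1 T).inf' (nonempty_Icc.mpr hT) M
  have hMmin : 0 < Mmin := (lt_inf'_iff _).mpr hM
  have hJmax {i : ℕ} (hi : i ∈ Icc 1 N) : J i ≤ Jmax := le_sup' J hi
  have hrho : 0 ≤ Jmax / Mmin :=
    div_nonneg ((hJ 1 (by simp [hN])).le.trans (hJmax (by simp [hN]))) hMmin.le
  have hF {i s : ℕ} (hi : i ∈ Icc 1 N) (hs : s ∈ Icc 1 T) : 0 ≤ U i s / J i :=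
    div_nonneg (hUnn i hi s hs) (hJ i hi).le
  have htier : ∀ t ∈ Icc 1 T,
      ∑ i ∈ Icc 1 N, xR i t * (U i t / J i - U i (l i) / J i) ≤
        Jmax / Mmin * ∑ i ∈ Icc 1 N, xR i t * (U i t / J i) := by
    intro t ht
    have htT := mem_Icc.mp ht
    have hpos {i : ℕ} (hi : i ∈ Icc 1 N)
        (h : 0 < xR i t * (U i t / J i - U i (l i) / J i)) :
        (0 < xR i t ∧ xR i t < J i) ∧ t < l i ∧ 0 < U i t / J i - U i (l i) / J i := by
      have hxp : 0 < xR i t := (hx i t).lt_of_ne fun h0 => by simp [← h0] at h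
      have hD := pos_of_mul_pos_right h hxp.le
      have htl : t < l i := by
        by_contra! hle
        have := hUmono i hi (l i) (mem_Icc.mpr ⟨hl1 i hi, hle.trans htT.2⟩) t hle htT.2
        have := div_le_div_of_nonneg_right this (hJ i hi).le
        linarith
      exact ⟨⟨hxp, hpart i hi t ht htl⟩, htl, hD⟩
    by_cases hall : ∀ i ∈ Icc 1 N, xR i t * (U i t / J i - U i (l i) / J i) ≤ 0
    · exact (sum_nonpos hall).trans
        (mul_nonneg hrho (sum_nonneg fun i hi => mul_nonneg (hx i t) (hF hi ht)))
    push Not at hall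
    obtain ⟨p, hp, hploss⟩ := hall
    obtain ⟨hpp, htl, hD⟩ := hpos hp hploss
    set D := U p t / J p - U p (l p) / J p with hDdef
    have hsum : ∑ i ∈ Icc 1 N, xR i t * (U i t / J i - U i (l i) / J i) ≤ xR p t * D := by
      rw [← add_sum_erase _ _ hp]
      have : ∑ i ∈ (Icc 1 N).erase p, xR i t * (U i t / J i - U i (l i) / J i) ≤ 0 := by
        refine sum_nonpos fun i hi => ?_
        have hi' := mem_erase.mp hi
        by_contra! h
        exact hi'.1 (honePartial t ht i hi'.2 p hp (hpos hi'.2 h).1 hpp)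
      linarith
    obtain ⟨kap, m, A, hm, hk0, hk1, hA, hAl, hAJ, hkD⟩ : ∃ (kap : ℝ) (m : ℕ) (A : ℝ),
        m ∈ Icc 1 T ∧ 0 ≤ kap ∧ kap ≤ 1 ∧ 0 < A ∧ kap * A ≤ xR p m ∧
        (1 - kap) * A ≤ J p - ∑ s ∈ Icc 1 T, xR p s ∧
        U p t / J p - kap * (U p m / J p) = D := by
      rcases (hlT p hp).lt_or_eq with h | h
      · obtain ⟨h1, h2⟩ := hdone p hp (by omega)
        exact ⟨1, l p, xR p (l p), mem_Icc.mpr ⟨hl1 p hp, by omega⟩, zero_le_one, le_rfl, h1,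
          by simp, by simp [h2], by simp [hDdef]⟩
      · exact ⟨0, t, J p - ∑ s ∈ Icc 1 T, xR p s, ht, le_rfl, zero_le_one,
          sub_pos.mpr (hopen p hp h), by simpa using hx p t, by simp,
          by simp [hDdef, h, hU0 p hp]⟩
    have hfull : ∑ i ∈ Icc 1 N, xR i t = M t := by
      refine le_antisymm (hxM t ht) ?_
      by_contra! h
      have := exchange_le hfeas hopt hp hp ht hm le_rfl zero_le_one hk0 hk1 hA (sub_pos.mpr h)
        hAl hAJ (by simpa using hx p t) (by simp)
      rw [hkD] at this
      linarith
    have hdom : ∀ q ∈ Icc 1 N, xR q t * D ≤ xR q t * (U q t / J q) := by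
      intro q hq
      rcases (hx q t).eq_or_lt with h | h
      · simp [← h]
      · have := exchange_le hfeas hopt hp hq ht hm zero_le_one le_rfl hk0 hk1 hA h
          hAl hAJ (by simp) (by simpa using hxM t ht)
        rw [hkD] at this
        have hnn := mul_nonneg hk0 (hF hq hm)
        exact mul_le_mul_of_nonneg_left (by linarith) h.le
    have hMD : M t * D ≤ ∑ i ∈ Icc 1 N, xR i t * (U i t / J i) := by
      rw [← hfull, sum_mul]
      exact sum_le_sum hdom
    calc _ ≤ xR p t * D := hsum
      _ ≤ Jmax * D := mul_le_mul_of_nonneg_right (hpp.2.le.trans (hJmax hp)) hD.le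
      _ = Jmax / Mmin * (Mmin * D) := by field_simp
      _ ≤ Jmax / Mmin * (M t * D) := by
        gcongr
        exact inf'_le M ht
      _ ≤ _ := mul_le_mul_of_nonneg_left hMD hrho
  have hloss : LPObj N T J U xR - roundedValue N T J U xR =
      ∑ t ∈ Icc 1 T, ∑ i ∈ Icc 1 N, xR i t * (U i t / J i - U i (l i) / J i) := by
    unfold LPObj roundedValue
    rw [sum_comm (s := Icc 1 T), sum_comm (s := Icc 1 T), ← sum_sub_distrib]
    refine sum_congr rfl fun i hi => ?_
    rw [hround i hi]
    simp only [mul_sub, sum_sub_distrib, ← sum_mul]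
    congr 1
    have := (hJ i hi).ne'
    rcases (hlT i hi).lt_or_eq with h | h
    · rw [(hdone i hi (by omega)).2]
      field_simp
    · simp [h, hU0 i hi]
  have hobj : LPObj N T J U xR = ∑ t ∈ Icc 1 T, ∑ i ∈ Icc 1 N, xR i t * (U i t / J i) :=
    sum_comm
  have hfinal := sum_le_sum htier
  rw [← hloss, ← mul_sum, ← hobj] at hfinal
  linarith
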